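/- arXiv:2305.09140 — 3 statements merged into one kernel-verified Lean document; each statement's English description precedes it below -/
import Mathlib

section
/- Let n ≥ 3, λ₁ > ⋯ > λₙ > 0, and s ∈ (0,1) with s ∉ {α_i, 1−α_i : i = 2,…,n−1}. Then [s,0,…,0]ᵀ ∈ ℝ^{n−1} is a fixed point of Θ∘Θ, and the spectrum of the derivative D(Θ∘Θ) at this fixed point consists of the eigenvalue 1 together with the n−2 eigenvalues μ_i(s) = ((s(1−s) − α_i(1−α_i)) / (s(1−s)))², i = 2,…,n−1. In particular, D(Θ∘Θ) at [s,0,…,0]ᵀ has an eigenvalue strictly larger than 1 if and only if s ∈ (0,1) ∖ I. -/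
open Finset Real

noncomputable section

/-- `λ̄(p) = ∑ⱼ λⱼ pⱼ`. -/
def lamMean {n : ℕ} (lam p : Fin n → ℝ) : ℝ := ∑ j, lam j * p j

/-- Akaike's map `T(p)ᵢ = pᵢ(λ̄(p) − λᵢ)² / ∑ⱼ pⱼ(λ̄(p) − λⱼ)²`. -/
def Tmap {n : ℕ} (lam : Fin n → ℝ) (p : Fin n → ℝ) : Fin n → ℝ := fun i =>
  p i * (lamMean lam p - lam i) ^ 2 / ∑ j, p j * (lamMean lam p - lam j) ^ 2

/-- Extension of `(p₁,…,p_{n-1})` to a full vector with `pₙ = 1 − ∑_{j<n} pⱼ`. -/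
def extendP {n : ℕ} (p : Fin (n - 1) → ℝ) : Fin n → ℝ := fun j =>
  if h : (j : ℕ) < n - 1 then p ⟨(j : ℕ), h⟩ else 1 - ∑ i, p i

/-- `Θ`, the representation of Akaike's map `T` in the coordinates `(p₁,…,p_{n-1})`. -/
def Theta {n : ℕ} (lam : Fin n → ℝ) (p : Fin (n - 1) → ℝ) : Fin (n - 1) → ℝ := fun i =>
  Tmap lam (extendP p) (Fin.castLE (Nat.sub_le n 1) i)

/-- A continuous endomorphism fixing the basis vector `eₖ` and acting diagonally on all other
coordinates has the expected triangular spectrum. -/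
lemma spectrum_eq_of_fixes_single {ι : Type*} [Fintype ι] [DecidableEq ι]
    (M : (ι → ℝ) →L[ℝ] (ι → ℝ)) (k : ι) (μ : ι → ℝ)
    (hk : M (Pi.single k 1) = Pi.single k 1) (hM : ∀ i ≠ k, ∀ v, M v i = μ i * v i) :
    spectrum ℝ M = {1} ∪ μ '' {i | i ≠ k} := by
  ext r
  have happ : ∀ v, (algebraMap ℝ ((ι → ℝ) →L[ℝ] (ι → ℝ)) r - M) v = r • v - M v := fun v => by
    simp [Algebra.algebraMap_eq_smul_one]
  rw [spectrum.mem_iff, ContinuousLinearMap.isUnit_iff_bijective]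
  constructor
  · contrapose!
    intro hr
    simp only [Set.mem_union, Set.mem_singleton_iff, Set.mem_image, Set.mem_ofPred_eq, not_or,
      not_exists, not_and] at hr
    obtain ⟨hr1, hrμ⟩ := hr
    have hinj : Function.Injective (algebraMap ℝ ((ι → ℝ) →L[ℝ] (ι → ℝ)) r - M) := by
      rw [injective_iff_map_eq_zero]
      intro v hv
      rw [happ, sub_eq_zero] at hv
      have hoff : ∀ i ≠ k, v i = 0 := by
        intro i hi
        have h := congrFun hv i
        rw [hM i hi, Pi.smul_apply, smul_eq_mul] at h
        have h' : (r - μ i) * v i = 0 := by linarith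
        exact (mul_eq_zero.1 h').resolve_left (sub_ne_zero.2 fun e => hrμ i hi e.symm)
      have hv' : v = v k • Pi.single k (1 : ℝ) := by
        ext i
        by_cases hi : i = k
        · subst hi; simp
        · simp [hoff i hi, hi]
      rw [hv', map_smul, hk] at hv
      have h := congrFun hv k
      simp only [Pi.smul_apply, Pi.single_eq_same, smul_eq_mul, mul_one] at h
      have h' : (r - 1) * v k = 0 := by linarith
      rw [hv', (mul_eq_zero.1 h').resolve_left (sub_ne_zero.2 hr1), zero_smul]
    exact ⟨hinj, (LinearMap.injective_iff_surjective
      (f := (algebraMap ℝ ((ι → ℝ) →L[ℝ] (ι → ℝ)) r - M).toLinearMap)).1 hinj⟩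
  · rintro (rfl | ⟨i, hi, rfl⟩) ⟨hinj, hsurj⟩
    · have h := hinj (a₁ := Pi.single k 1) (a₂ := 0) (by rw [happ, hk]; simp)
      simpa using congrFun h k
    · obtain ⟨v, hv⟩ := hsurj (Pi.single i 1)
      have h := congrFun hv i
      rw [happ, Pi.sub_apply, hM i hi] at h
      simp at h

/-- The factor by which Akaike's map multiplies the `i`-th coordinate, in the coordinates
`(p₁,…,p_{n-1})`. -/
def stepFactor {n : ℕ} (lam : Fin n → ℝ) (i : Fin n) (p : Fin (n - 1) → ℝ) : ℝ :=
  (lamMean lam (extendP p) - lam i) ^ 2 /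
    ∑ j, extendP p j * (lamMean lam (extendP p) - lam j) ^ 2

lemma Theta_apply {n : ℕ} (lam : Fin n → ℝ) (p : Fin (n - 1) → ℝ) (i : Fin (n - 1)) :
    Theta lam p i = p i * stepFactor lam (Fin.castLE (Nat.sub_le n 1) i) p := by
  have h : extendP p (Fin.castLE (Nat.sub_le n 1) i) = p i := by simp [extendP, i.2]
  simp only [Theta, Tmap, stepFactor, h, mul_div_assoc]

/-- The point `[t,0,…,0]`. -/
def edgePoint (n : ℕ) (t : ℝ) : Fin (n - 1) → ℝ := fun i => if (i : ℕ) = 0 then t else 0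

lemma edgePoint_eq_single {n : ℕ} (hn : 2 ≤ n) (t : ℝ) :
    edgePoint n t = Pi.single (⟨0, by omega⟩ : Fin (n - 1)) t := by
  ext i
  simp [edgePoint, Pi.single_apply, Fin.ext_iff]

lemma sum_extendP_edgePoint_mul {n : ℕ} (hn : 2 ≤ n) (t : ℝ) (f : Fin n → ℝ) :
    ∑ j, extendP (edgePoint n t) j * f j =
      t * f ⟨0, by omega⟩ + (1 - t) * f ⟨n - 1, by omega⟩ := by
  have h : extendP (edgePoint n t) =
      Pi.single (⟨0, by omega⟩ : Fin n) t + Pi.single (⟨n - 1, by omega⟩ : Fin n) (1 - t) := by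
    ext j
    have hsum : ∑ i, edgePoint n t i = t := by
      rw [edgePoint_eq_single hn]; simp
    have hj := j.2
    rw [extendP, hsum]
    simp only [edgePoint, Pi.add_apply, Pi.single_apply, Fin.ext_iff]
    split_ifs <;> first | omega | simp
  rw [h]
  simp [add_mul, Finset.sum_add_distrib, Pi.single_apply]

lemma lamMean_edgePoint {n : ℕ} (hn : 2 ≤ n) (lam : Fin n → ℝ) (t : ℝ) :
    lamMean lam (extendP (edgePoint n t)) =
      t * lam ⟨0, by omega⟩ + (1 - t) * lam ⟨n - 1, by omega⟩ := by
  rw [← sum_extendP_edgePoint_mul hn, lamMean]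
  exact Finset.sum_congr rfl fun _ _ => mul_comm _ _

lemma variance_edgePoint {n : ℕ} (hn : 2 ≤ n) (lam : Fin n → ℝ) (t : ℝ) :
    ∑ j, extendP (edgePoint n t) j * (lamMean lam (extendP (edgePoint n t)) - lam j) ^ 2 =
      t * (1 - t) * (lam ⟨0, by omega⟩ - lam ⟨n - 1, by omega⟩) ^ 2 := by
  rw [sum_extendP_edgePoint_mul hn, lamMean_edgePoint hn]
  ring

lemma stepFactor_edgePoint {n : ℕ} (hn : 2 ≤ n) (lam : Fin n → ℝ)
    (hlam : lam ⟨0, by omega⟩ - lam ⟨n - 1, by omega⟩ ≠ 0) (t : ℝ) (i : Fin n) :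
    stepFactor lam i (edgePoint n t) =
      (t - (lam i - lam ⟨n - 1, by omega⟩) / (lam ⟨0, by omega⟩ - lam ⟨n - 1, by omega⟩)) ^ 2 /
        (t * (1 - t)) := by
  rw [stepFactor, variance_edgePoint hn, lamMean_edgePoint hn]
  set d := lam ⟨0, by omega⟩ - lam ⟨n - 1, by omega⟩ with hd
  have : t * lam ⟨0, by omega⟩ + (1 - t) * lam ⟨n - 1, by omega⟩ - lam i =
      (t - (lam i - lam ⟨n - 1, by omega⟩) / d) * d := by
    rw [sub_mul _ (_ / d), div_mul_cancel₀ _ hlam, hd]; ring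
  rw [this, mul_pow, mul_div_mul_right _ _ (pow_ne_zero 2 hlam)]

lemma Theta_edgePoint {n : ℕ} (hn : 2 ≤ n) (lam : Fin n → ℝ)
    (hlam : lam ⟨0, by omega⟩ - lam ⟨n - 1, by omega⟩ ≠ 0) {t : ℝ} (ht : t ∈ Set.Ioo (0 : ℝ) 1) :
    Theta lam (edgePoint n t) = edgePoint n (1 - t) := by
  ext i
  rw [Theta_apply, stepFactor_edgePoint hn lam hlam]
  by_cases hi : (i : ℕ) = 0
  · have hi' : Fin.castLE (Nat.sub_le n 1) i = ⟨0, by omega⟩ := Fin.ext hi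
    have h0 : t ≠ 0 := ht.1.ne'
    have h1 : 1 - t ≠ 0 := (sub_pos.2 ht.2).ne'
    rw [hi', div_self hlam]
    simp only [edgePoint, hi, if_true]
    field_simp
    ring
  · simp [edgePoint, hi]

lemma differentiableAt_stepFactor {n : ℕ} (hn : 2 ≤ n) (lam : Fin n → ℝ)
    (hlam : lam ⟨0, by omega⟩ - lam ⟨n - 1, by omega⟩ ≠ 0) {t : ℝ} (ht : t ∈ Set.Ioo (0 : ℝ) 1)
    (i : Fin n) : DifferentiableAt ℝ (stepFactor lam i) (edgePoint n t) := by
  have hext : ∀ j, Differentiable ℝ fun p : Fin (n - 1) → ℝ => (extendP p : Fin n → ℝ) j := by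
    intro j
    unfold extendP
    split_ifs <;> fun_prop
  have hmean : Differentiable ℝ fun p : Fin (n - 1) → ℝ => lamMean lam (extendP p) := by
    unfold lamMean
    fun_prop
  unfold stepFactor
  simp only [div_eq_mul_inv]
  refine DifferentiableAt.fun_mul ?_ (DifferentiableAt.fun_inv ?_ ?_)
  · exact ((hmean.sub_const _).pow 2) _
  · exact (Differentiable.fun_sum fun j _ => (hext j).mul ((hmean.sub_const _).pow 2)) _
  · rw [variance_edgePoint hn]
    exact mul_ne_zero (mul_pos ht.1 (sub_pos.2 ht.2)).ne' (pow_ne_zero 2 hlam)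

lemma differentiableAt_Theta {n : ℕ} (hn : 2 ≤ n) (lam : Fin n → ℝ)
    (hlam : lam ⟨0, by omega⟩ - lam ⟨n - 1, by omega⟩ ≠ 0) {t : ℝ} (ht : t ∈ Set.Ioo (0 : ℝ) 1) :
    DifferentiableAt ℝ (Theta lam) (edgePoint n t) := by
  rw [differentiableAt_pi]
  intro i
  simp only [Theta_apply]
  exact DifferentiableAt.fun_mul (by fun_prop) (differentiableAt_stepFactor hn lam hlam ht _)

lemma Theta_Theta_edgePoint {n : ℕ} (hn : 2 ≤ n) (lam : Fin n → ℝ)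
    (hlam : lam ⟨0, by omega⟩ - lam ⟨n - 1, by omega⟩ ≠ 0) {t : ℝ} (ht : t ∈ Set.Ioo (0 : ℝ) 1) :
    (Theta lam ∘ Theta lam) (edgePoint n t) = edgePoint n t := by
  have ht' : 1 - t ∈ Set.Ioo (0 : ℝ) 1 := ⟨sub_pos.2 ht.2, by linarith [ht.1]⟩
  rw [Function.comp_apply, Theta_edgePoint hn lam hlam ht, Theta_edgePoint hn lam hlam ht',
    sub_sub_cancel]

lemma differentiableAt_Theta_comp_Theta {n : ℕ} (hn : 2 ≤ n) (lam : Fin n → ℝ)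
    (hlam : lam ⟨0, by omega⟩ - lam ⟨n - 1, by omega⟩ ≠ 0) {t : ℝ} (ht : t ∈ Set.Ioo (0 : ℝ) 1) :
    DifferentiableAt ℝ (Theta lam ∘ Theta lam) (edgePoint n t) := by
  refine DifferentiableAt.comp _ ?_ (differentiableAt_Theta hn lam hlam ht)
  rw [Theta_edgePoint hn lam hlam ht]
  exact differentiableAt_Theta hn lam hlam ⟨sub_pos.2 ht.2, by linarith [ht.1]⟩

lemma fderiv_Theta_comp_Theta_single {n : ℕ} (hn : 2 ≤ n) (lam : Fin n → ℝ)
    (hlam : lam ⟨0, by omega⟩ - lam ⟨n - 1, by omega⟩ ≠ 0) {t : ℝ} (ht : t ∈ Set.Ioo (0 : ℝ) 1) :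
    fderiv ℝ (Theta lam ∘ Theta lam) (edgePoint n t) (Pi.single ⟨0, by omega⟩ 1) =
      Pi.single ⟨0, by omega⟩ 1 := by
  have hedge : HasDerivAt (edgePoint n) (Pi.single ⟨0, by omega⟩ 1) t := by
    rw [hasDerivAt_pi]
    intro i
    rw [← edgePoint_eq_single hn]
    by_cases hi : (i : ℕ) = 0
    · simpa [edgePoint, hi] using hasDerivAt_id' t
    · simpa [edgePoint, hi] using hasDerivAt_const t (0 : ℝ)
  have hcomp := (differentiableAt_Theta_comp_Theta hn lam hlam ht).hasFDerivAt.comp_hasDerivAt t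
    hedge
  refine hcomp.unique (hedge.congr_of_eventuallyEq ?_)
  filter_upwards [isOpen_Ioo.mem_nhds ht] with u hu
  exact Theta_Theta_edgePoint hn lam hlam hu

lemma fderiv_Theta_comp_Theta_apply {n : ℕ} (hn : 2 ≤ n) (lam : Fin n → ℝ)
    (hlam : lam ⟨0, by omega⟩ - lam ⟨n - 1, by omega⟩ ≠ 0) {t : ℝ} (ht : t ∈ Set.Ioo (0 : ℝ) 1)
    {i : Fin (n - 1)} (hi : (i : ℕ) ≠ 0) (v : Fin (n - 1) → ℝ) :
    fderiv ℝ (Theta lam ∘ Theta lam) (edgePoint n t) v i =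
      stepFactor lam (Fin.castLE (Nat.sub_le n 1) i) (edgePoint n t) *
        stepFactor lam (Fin.castLE (Nat.sub_le n 1) i) (edgePoint n (1 - t)) * v i := by
  have ht' : 1 - t ∈ Set.Ioo (0 : ℝ) 1 := ⟨sub_pos.2 ht.2, by linarith [ht.1]⟩
  set k := Fin.castLE (Nat.sub_le n 1) i
  have hsecond : DifferentiableAt ℝ (fun p => stepFactor lam k (Theta lam p)) (edgePoint n t) := by
    have houter : DifferentiableAt ℝ (stepFactor lam k) (Theta lam (edgePoint n t)) := by
      rw [Theta_edgePoint hn lam hlam ht]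
      exact differentiableAt_stepFactor hn lam hlam ht' k
    exact houter.comp _ (differentiableAt_Theta hn lam hlam ht)
  have hfactor := (differentiableAt_stepFactor hn lam hlam ht k).fun_mul hsecond
  have hmul := (hasFDerivAt_apply (𝕜 := ℝ) i (edgePoint n t)).mul hfactor.hasFDerivAt
  have hcoord := hasFDerivAt_pi'.1
    (differentiableAt_Theta_comp_Theta hn lam hlam ht).hasFDerivAt i
  have heq : (fun p => (Theta lam ∘ Theta lam) p i) =
      (fun p => p i) * fun p => stepFactor lam k p * stepFactor lam k (Theta lam p) := by
    ext p
    simp only [Function.comp_apply, Theta_apply _ _ i, Pi.mul_apply, mul_assoc, k]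
  rw [heq] at hcoord
  have h := DFunLike.congr_fun (hcoord.unique hmul) v
  have hzero : edgePoint n t i = 0 := by simp [edgePoint, hi]
  simpa [hzero, Theta_edgePoint hn lam hlam ht] using h

lemma mem_compl_stability_interval_iff {s a : ℝ} :
    ¬ |s - 1 / 2| ≤ 1 / 2 * √(1 - 2 * a * (1 - a)) ↔ 2 * (s * (1 - s)) < a * (1 - a) := by
  have hnonneg : 0 ≤ 1 - 2 * a * (1 - a) := by nlinarith [sq_nonneg (a - 1 / 2)]
  rw [not_le, ← abs_of_nonneg (by positivity : 0 ≤ 1 / 2 * √(1 - 2 * a * (1 - a))),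
    ← sq_lt_sq, mul_pow, Real.sq_sqrt hnonneg]
  constructor <;> intro h <;> nlinarith

lemma one_lt_sq_sub_div_iff {x y : ℝ} (hx : 0 < x) (hy : 0 ≤ y) :
    1 < ((x - y) / x) ^ 2 ↔ 2 * x < y := by
  rw [div_pow, one_lt_div (by positivity)]
  constructor <;> intro h <;> nlinarith

/-- `[s,0,…,0]` is a fixed point of `Θ∘Θ`, the spectrum of `D(Θ∘Θ)` there
consists of the eigenvalue `1` together with the eigenvalues
`μᵢ(s) = ((s(1−s) − αᵢ(1−αᵢ))/(s(1−s)))²`, `i = 2,…,n−1`; in particular `D(Θ∘Θ)` has an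
eigenvalue `> 1` iff `s ∈ (0,1) ∖ I`. -/
theorem spectrum_DThetaSq_fixed_point (n : ℕ) (hn : 3 ≤ n) (lam : Fin n → ℝ)
    (hord : ∀ i j : Fin n, i < j → lam j < lam i)
    (hpos : 0 < lam ⟨n - 1, by omega⟩)
    (α : Fin n → ℝ)
    (hα : ∀ i, α i =
      (lam i - lam ⟨n - 1, by omega⟩) / (lam ⟨0, by omega⟩ - lam ⟨n - 1, by omega⟩))
    (istar : Fin n) (histar : 0 < (istar : ℕ) ∧ (istar : ℕ) < n - 1)
    (hmin : ∀ i : Fin n, 0 < (i : ℕ) → (i : ℕ) < n - 1 →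
      |α istar - 1 / 2| ≤ |α i - 1 / 2|)
    (I : Set ℝ)
    (hI : I = {t : ℝ | |t - 1 / 2| ≤ 1 / 2 * Real.sqrt (1 - 2 * α istar * (1 - α istar))})
    (s : ℝ) (hs : s ∈ Set.Ioo (0 : ℝ) 1)
    (hsne : ∀ i : Fin n, 0 < (i : ℕ) → (i : ℕ) < n - 1 → s ≠ α i ∧ s ≠ 1 - α i)
    (p0 : Fin (n - 1) → ℝ) (hp0 : p0 = fun i : Fin (n - 1) => if (i : ℕ) = 0 then s else 0) :
    (Theta lam ∘ Theta lam) p0 = p0 ∧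
    spectrum ℝ (fderiv ℝ (Theta lam ∘ Theta lam) p0) =
      {1} ∪ ((fun i : Fin n => ((s * (1 - s) - α i * (1 - α i)) / (s * (1 - s))) ^ 2) ''
        {i : Fin n | 0 < (i : ℕ) ∧ (i : ℕ) < n - 1}) ∧
    ((∃ μ ∈ spectrum ℝ (fderiv ℝ (Theta lam ∘ Theta lam) p0), 1 < μ) ↔
      s ∈ Set.Ioo (0 : ℝ) 1 \ I) := by
  have hn2 : 2 ≤ n := by omega
  have hlam : 0 < lam ⟨0, by omega⟩ - lam ⟨n - 1, by omega⟩ :=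
    sub_pos.2 (hord _ _ (Fin.mk_lt_mk.2 (by omega)))
  obtain rfl : p0 = edgePoint n s := hp0
  have hx : 0 < s * (1 - s) := mul_pos hs.1 (sub_pos.2 hs.2)
  have hspec : spectrum ℝ (fderiv ℝ (Theta lam ∘ Theta lam) (edgePoint n s)) =
      {1} ∪ ((fun i : Fin n => ((s * (1 - s) - α i * (1 - α i)) / (s * (1 - s))) ^ 2) ''
        {i : Fin n | 0 < (i : ℕ) ∧ (i : ℕ) < n - 1}) := by
    rw [spectrum_eq_of_fixes_single _ ⟨0, by omega⟩
      (fun i => ((s * (1 - s) - α (Fin.castLE (Nat.sub_le n 1) i) *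
        (1 - α (Fin.castLE (Nat.sub_le n 1) i))) / (s * (1 - s))) ^ 2)
      (fderiv_Theta_comp_Theta_single hn2 lam hlam.ne' hs)]
    · congr 1
      ext r
      constructor
      · rintro ⟨i, hi, rfl⟩
        exact ⟨Fin.castLE (Nat.sub_le n 1) i,
          ⟨Nat.pos_of_ne_zero fun h => hi (Fin.ext h), i.2⟩, rfl⟩
      · rintro ⟨i, ⟨hi0, hi⟩, rfl⟩
        exact ⟨⟨i, hi⟩, fun h => hi0.ne' (Fin.ext_iff.1 h), rfl⟩
    · intro i hi v
      rw [fderiv_Theta_comp_Theta_apply hn2 lam hlam.ne' hs fun h => hi (Fin.ext h),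
        stepFactor_edgePoint hn2 lam hlam.ne', stepFactor_edgePoint hn2 lam hlam.ne', ← hα]
      have h0 : s ≠ 0 := hs.1.ne'
      have h1 : 1 - s ≠ 0 := (sub_pos.2 hs.2).ne'
      rw [sub_sub_cancel]
      field_simp
      ring
  refine ⟨Theta_Theta_edgePoint hn2 lam hlam.ne' hs, hspec, ?_⟩
  have hαnonneg : ∀ i : Fin n, 0 ≤ α i * (1 - α i) := by
    have hanti : StrictAnti lam := fun i j h => hord i j h
    intro i
    have hlast : lam ⟨n - 1, by omega⟩ ≤ lam i :=
      hanti.antitone (Fin.mk_le_mk.2 (Nat.le_sub_one_of_lt i.2))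
    have hfirst : lam i ≤ lam ⟨0, by omega⟩ := hanti.antitone (Fin.mk_le_mk.2 (Nat.zero_le i))
    rw [hα]
    refine mul_nonneg (div_nonneg (by linarith) hlam.le) (sub_nonneg.2 ?_)
    rw [div_le_one hlam]
    linarith
  rw [hspec, hI, Set.mem_sdiff, Set.mem_ofPred_eq, mem_compl_stability_interval_iff]
  constructor
  · rintro ⟨r, (rfl | ⟨i, hi, rfl⟩), hr⟩
    · exact absurd hr (lt_irrefl 1)
    · refine ⟨hs, ((one_lt_sq_sub_div_iff hx (hαnonneg i)).1 hr).trans_le ?_⟩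
      have h := sq_le_sq.2 (hmin i hi.1 hi.2)
      nlinarith
  · rintro ⟨-, h⟩
    exact ⟨_, Or.inr ⟨istar, histar, rfl⟩, (one_lt_sq_sub_div_iff hx (hαnonneg istar)).2 h⟩

end
end

section
/- For every a ∈ (0,1), define ρ̄²(s,a) = 1 − (1−s+sa)^{−1}(1−s+s/a)^{−1} for s ∈ [0,1], and s(θ) = a²sin²θ/(cos²θ + a²sin²θ). Then the average square shrinking factor over the circle has the closed form (π/2)^{−1} ∫₀^{π/2} ρ̄²(s(θ), a) dθ = √a (1−√a)² / ((1+a)(1 − √a + a)). Equivalently, (π/2)^{−1} ∫₀^{π/2} ρ((cos θ, sin θ), (1,a))² dθ equals this value, where ρ is the one-step shrinking factor for A = diag(1,a). -/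
open MeasureTheory Filter Finset Real Metric

noncomputable section

/-- `qform lam k x = xᵀ Aᵏ x` for `A = diag lam`. -/
def qform {n : ℕ} (lam : Fin n → ℝ) (k : ℕ) (x : Fin n → ℝ) : ℝ :=
  ∑ i, lam i ^ k * x i ^ 2

/-- Exact line search gradient descent map for `f(x) = ½ xᵀAx`, `A = diag lam`;
`GD 0 = 0`. -/
def GD {n : ℕ} (lam : Fin n → ℝ) (x : Fin n → ℝ) : Fin n → ℝ :=
  if x = 0 then 0 else fun i => x i - qform lam 2 x / qform lam 3 x * (lam i * x i)

/-- One-step shrinking factor `ρ(x, λ)`, with the convention `ρ(0, λ) = 0`. -/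
def shrink {n : ℕ} (lam : Fin n → ℝ) (x : Fin n → ℝ) : ℝ :=
  if x = 0 then 0 else
    Real.sqrt (1 - (qform lam 2 x) ^ 2 / (qform lam 1 x * qform lam 3 x))

/-- Rate of convergence `ρ*(x⁰, λ)` of exact line search gradient descent from seed `x⁰`. -/
def rocGD {n : ℕ} (lam : Fin n → ℝ) (x0 : Fin n → ℝ) : ℝ :=
  Filter.limsup
    (fun k : ℕ => (∏ j ∈ Finset.range k, shrink lam ((GD lam)^[j] x0)) ^ ((k : ℝ)⁻¹))
    Filter.atTop

/-- `ρ̄²(s,a) = 1 − (1−s+sa)⁻¹(1−s+s/a)⁻¹`. -/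
def rhoBarSq (s a : ℝ) : ℝ := 1 - (1 - s + s * a)⁻¹ * (1 - s + s / a)⁻¹

/-- The simplex coordinate `s(θ) = a²sin²θ/(cos²θ + a²sin²θ)` of `(cos θ, sin θ)`. -/
def sOf (a θ : ℝ) : ℝ :=
  a ^ 2 * Real.sin θ ^ 2 / (Real.cos θ ^ 2 + a ^ 2 * Real.sin θ ^ 2)

theorem cos_sq_add_mul_sin_sq_pos {k : ℝ} (hk : 0 < k) (θ : ℝ) :
    0 < Real.cos θ ^ 2 + k * Real.sin θ ^ 2 := by
  rcases eq_or_ne (Real.sin θ) 0 with h | h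
  · have := Real.sin_sq_add_cos_sq θ
    rw [h] at this ⊢
    nlinarith
  · positivity

theorem continuous_inv_cos_sq_add_mul_sin_sq {k : ℝ} (hk : 0 < k) :
    Continuous fun θ : ℝ => (Real.cos θ ^ 2 + k * Real.sin θ ^ 2)⁻¹ :=
  Continuous.inv₀ (by fun_prop) fun θ => (cos_sq_add_mul_sin_sq_pos hk θ).ne'

/-- A global primitive, agreeing with `arctan (p * tan θ)` on `(-π/2, π/2)`. -/
theorem hasDerivAt_add_arctan {p : ℝ} (hp : 0 < p) (θ : ℝ) :
    HasDerivAt (fun θ : ℝ => θ + Real.arctan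
        ((p - 1) * (Real.sin θ * Real.cos θ) / (Real.cos θ ^ 2 + p * Real.sin θ ^ 2)))
      (p * (Real.cos θ ^ 2 + p ^ 2 * Real.sin θ ^ 2)⁻¹) θ := by
  have hD := (cos_sq_add_mul_sin_sq_pos hp θ).ne'
  have hE := (cos_sq_add_mul_sin_sq_pos (pow_pos hp 2) θ).ne'
  have hs := Real.hasDerivAt_sin θ
  have hc := Real.hasDerivAt_cos θ
  have key := (hasDerivAt_id θ).add
    (((hs.mul hc).const_mul (p - 1)).div ((hc.pow 2).add ((hs.pow 2).const_mul p)) hD).arctan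
  refine key.congr_deriv ?_
  have hsc := Real.sin_sq_add_cos_sq θ
  simp only [Pi.mul_apply, Pi.add_apply, Pi.pow_apply, Pi.div_apply]
  generalize Real.sin θ = s at *
  generalize Real.cos θ = c at *
  have hN : (c ^ 2 + p * s ^ 2) ^ 2 + ((p - 1) * (s * c)) ^ 2 = c ^ 2 + p ^ 2 * s ^ 2 := by
    linear_combination (c ^ 2 + p ^ 2 * s ^ 2) * hsc
  have hF : 1 + ((p - 1) * (s * c) / (c ^ 2 + p * s ^ 2)) ^ 2 =
      (c ^ 2 + p ^ 2 * s ^ 2) / (c ^ 2 + p * s ^ 2) ^ 2 := by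
    rw [← hN]; field_simp
  rw [hF]
  field_simp
  push_cast
  linear_combination ((p - 1) * (c ^ 2 - p * s ^ 2) + p) * hsc

theorem integral_inv_cos_sq_add_sq_mul_sin_sq {p : ℝ} (hp : 0 < p) :
    ∫ θ in (0 : ℝ)..(π / 2), (Real.cos θ ^ 2 + p ^ 2 * Real.sin θ ^ 2)⁻¹ = π / 2 / p := by
  have h := intervalIntegral.integral_eq_sub_of_hasDerivAt
    (a := 0) (b := π / 2) (fun θ _ => hasDerivAt_add_arctan hp θ)
    (((continuous_inv_cos_sq_add_mul_sin_sq (pow_pos hp 2)).const_mul p).intervalIntegrable _ _)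
  rw [intervalIntegral.integral_const_mul] at h
  rw [eq_div_iff hp.ne', mul_comm, h]
  simp

theorem rhoBarSq_sOf {a : ℝ} (ha : 0 < a) (θ : ℝ) :
    rhoBarSq (sOf a θ) a = 1 - (Real.cos θ ^ 2 + a ^ 2 * Real.sin θ ^ 2) ^ 2 /
      ((Real.cos θ ^ 2 + a * Real.sin θ ^ 2) * (Real.cos θ ^ 2 + a ^ 3 * Real.sin θ ^ 2)) := by
  have hD := (cos_sq_add_mul_sin_sq_pos (pow_pos ha 2) θ).ne'
  unfold rhoBarSq sOf
  generalize Real.sin θ = s at *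
  generalize Real.cos θ = c at *
  have h1 : 1 - a ^ 2 * s ^ 2 / (c ^ 2 + a ^ 2 * s ^ 2) +
      a ^ 2 * s ^ 2 / (c ^ 2 + a ^ 2 * s ^ 2) * a =
      (c ^ 2 + a ^ 3 * s ^ 2) / (c ^ 2 + a ^ 2 * s ^ 2) := by field_simp; ring
  have h2 : 1 - a ^ 2 * s ^ 2 / (c ^ 2 + a ^ 2 * s ^ 2) +
      a ^ 2 * s ^ 2 / (c ^ 2 + a ^ 2 * s ^ 2) / a =
      (c ^ 2 + a * s ^ 2) / (c ^ 2 + a ^ 2 * s ^ 2) := by field_simp; ring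
  rw [h1, h2, inv_div, inv_div, div_mul_div_comm, ← sq, mul_comm (c ^ 2 + a ^ 3 * s ^ 2)]

theorem rhoBarSq_sOf_eq_sub {a : ℝ} (ha : a ∈ Set.Ioo (0 : ℝ) 1) (θ : ℝ) :
    rhoBarSq (sOf a θ) a = (1 - a) / (1 + a) *
      ((1 - a ^ 3 * (Real.cos θ ^ 2 + a ^ 3 * Real.sin θ ^ 2)⁻¹) / (1 - a ^ 3) -
        (1 - a * (Real.cos θ ^ 2 + a * Real.sin θ ^ 2)⁻¹) / (1 - a)) := by
  obtain ⟨h0, h1⟩ := ha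
  have hX := (cos_sq_add_mul_sin_sq_pos h0 θ).ne'
  have hY := (cos_sq_add_mul_sin_sq_pos (pow_pos h0 3) θ).ne'
  have hsc := Real.sin_sq_add_cos_sq θ
  have h1a : 1 - a ≠ 0 := by linarith
  have h1a3 : 1 - a ^ 3 ≠ 0 := (sub_pos.2 (pow_lt_one₀ h0.le h1 three_ne_zero)).ne'
  have h1p : 1 + a ≠ 0 := by positivity
  rw [rhoBarSq_sOf h0]
  generalize Real.sin θ = s at *
  generalize Real.cos θ = c at *
  have cos_sq_div : ∀ k : ℝ, 1 - k ≠ 0 → c ^ 2 + k * s ^ 2 ≠ 0 →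
      (1 - k * (c ^ 2 + k * s ^ 2)⁻¹) / (1 - k) = c ^ 2 / (c ^ 2 + k * s ^ 2) := by
    intro k hk hk'
    field_simp
    linear_combination k * hsc
  rw [cos_sq_div _ h1a3 hY, cos_sq_div _ h1a hX]
  field_simp
  ring

theorem shrink_sq_eq {a : ℝ} (h0 : 0 < a) (θ : ℝ) :
    shrink ![1, a] ![Real.cos θ, Real.sin θ] ^ 2 = rhoBarSq (sOf a θ) a := by
  have hX := cos_sq_add_mul_sin_sq_pos h0 θ
  have hY := cos_sq_add_mul_sin_sq_pos (pow_pos h0 3) θ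
  have hne : ![Real.cos θ, Real.sin θ] ≠ 0 := by
    intro h
    have hc : Real.cos θ = 0 := congrFun h 0
    have hs : Real.sin θ = 0 := congrFun h 1
    simpa [hc, hs] using Real.sin_sq_add_cos_sq θ
  rw [rhoBarSq_sOf h0, shrink, if_neg hne, Real.sq_sqrt]
  · simp only [qform, Fin.sum_univ_two, Matrix.cons_val_zero, Matrix.cons_val_one, one_pow, one_mul,
      pow_one]
  · simp only [qform, Fin.sum_univ_two, Matrix.cons_val_zero, Matrix.cons_val_one, one_pow, one_mul,
      pow_one]
    rw [sub_nonneg, div_le_one (mul_pos hX hY), ← sub_nonneg]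
    have : 0 ≤ a * (1 - a) ^ 2 * (Real.cos θ ^ 2 * Real.sin θ ^ 2) := by positivity
    linarith

theorem integral_rhoBarSq_sOf {a : ℝ} (ha : a ∈ Set.Ioo (0 : ℝ) 1) :
    ((π / 2)⁻¹ * ∫ θ in (0 : ℝ)..(π / 2), rhoBarSq (sOf a θ) a) =
      Real.sqrt a * (1 - Real.sqrt a) ^ 2 / ((1 + a) * (1 - Real.sqrt a + a)) := by
  obtain ⟨b, hb, rfl⟩ : ∃ b : ℝ, 0 < b ∧ b ^ 2 = a :=
    ⟨√a, Real.sqrt_pos.2 ha.1, Real.sq_sqrt ha.1.le⟩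
  have hb1 : b < 1 := by nlinarith [ha.2]
  have hI : ∀ k : ℝ, 0 < k → IntervalIntegrable
      (fun θ : ℝ => (1 - k * (Real.cos θ ^ 2 + k * Real.sin θ ^ 2)⁻¹) / (1 - k))
      volume 0 (π / 2) := fun k hk =>
    ((continuous_const.sub ((continuous_inv_cos_sq_add_mul_sin_sq hk).const_mul k)).div_const
      _).intervalIntegrable _ _
  have hJ : ∀ p : ℝ, 0 < p → p < 1 →
      ∫ θ in (0 : ℝ)..(π / 2),
        (1 - p ^ 2 * (Real.cos θ ^ 2 + p ^ 2 * Real.sin θ ^ 2)⁻¹) / (1 - p ^ 2) =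
      π / 2 / (1 + p) := by
    intro p hp hp1
    rw [intervalIntegral.integral_div, intervalIntegral.integral_sub (by simp)
      (((continuous_inv_cos_sq_add_mul_sin_sq (pow_pos hp 2)).const_mul _).intervalIntegrable _ _),
      intervalIntegral.integral_const_mul, integral_inv_cos_sq_add_sq_mul_sin_sq hp]
    have h1 : 1 - p ≠ 0 := by linarith
    have h2 : 1 - p ^ 2 = (1 - p) * (1 + p) := by ring
    rw [h2]
    simp only [intervalIntegral.integral_const, smul_eq_mul, mul_one, sub_zero]
    field_simp
  have hJ3 := hJ (b ^ 3) (by positivity) (pow_lt_one₀ hb.le hb1 three_ne_zero)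
  rw [show (b ^ 3) ^ 2 = (b ^ 2) ^ 3 by ring] at hJ3
  simp_rw [rhoBarSq_sOf_eq_sub ha]
  rw [intervalIntegral.integral_const_mul,
    intervalIntegral.integral_sub (hI _ (by positivity)) (hI _ (by positivity)), hJ3, hJ b hb hb1,
    Real.sqrt_sq hb.le]
  have h1 : 1 - b + b ^ 2 ≠ 0 := by nlinarith
  have h2 : 1 + b ^ 3 = (1 + b) * (1 - b + b ^ 2) := by ring
  rw [h2]
  field_simp
  ring

/-- closed form for the average square shrinking factor over the circle. -/
theorem avg_square_shrink_closed_form (a : ℝ) (ha : a ∈ Set.Ioo (0 : ℝ) 1) :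
    ((π / 2)⁻¹ * ∫ θ in (0 : ℝ)..(π / 2), rhoBarSq (sOf a θ) a =
        Real.sqrt a * (1 - Real.sqrt a) ^ 2 /
          ((1 + a) * (1 - Real.sqrt a + a))) ∧
    ((π / 2)⁻¹ * ∫ θ in (0 : ℝ)..(π / 2),
          (shrink ![1, a] ![Real.cos θ, Real.sin θ]) ^ 2 =
        Real.sqrt a * (1 - Real.sqrt a) ^ 2 /
          ((1 + a) * (1 - Real.sqrt a + a))) := by
  refine ⟨integral_rhoBarSq_sOf ha, ?_⟩
  simp_rw [shrink_sq_eq ha.1]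
  exact integral_rhoBarSq_sOf ha

end
end

section
/- Let U ⊆ ℝ^m be open, m ≥ n, and let f : U → ℝⁿ be a C¹ map such that the derivative Df(x) has rank n for Lebesgue-almost every x ∈ U. Then for every Lebesgue-null set N ⊆ ℝⁿ, the preimage f^{−1}(N) is a Lebesgue-null set in ℝ^m. -/
open MeasureTheory
open Filter Topology
open scoped NNReal ENNReal

/-- The preimage of a null set under a surjective linear map is null. -/
theorem addHaar_preimage_linearMap_eq_zero {E F : Type*}
    [NormedAddCommGroup E] [NormedSpace ℝ E] [FiniteDimensional ℝ E]
    [MeasurableSpace E] [BorelSpace E]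
    [NormedAddCommGroup F] [NormedSpace ℝ F] [MeasurableSpace F] [BorelSpace F]
    (μ : Measure E) [μ.IsAddHaarMeasure] (ν : Measure F) [ν.IsAddHaarMeasure]
    {L : E →ₗ[ℝ] F} (hL : Function.Surjective L) {N : Set F} (hN : ν N = 0) :
    μ (L ⁻¹' N) = 0 := by
  obtain ⟨c, -, hc⟩ := L.exists_map_addHaar_eq_smul_addHaar μ ν hL
  have hLm : AEMeasurable L μ := L.continuous_of_finiteDimensional.aemeasurable
  refine nonpos_iff_eq_zero.1 ((Measure.le_map_apply hLm N).trans ?_)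
  simp [hc, hN]

/-- If `f` is strictly differentiable at `x` with surjective derivative, then near `x` the
preimage under `f` of a null set is null. -/
theorem HasStrictFDerivAt.exists_nhds_addHaar_preimage_inter_eq_zero {E F : Type*}
    [NormedAddCommGroup E] [NormedSpace ℝ E] [FiniteDimensional ℝ E]
    [MeasurableSpace E] [BorelSpace E]
    [NormedAddCommGroup F] [NormedSpace ℝ F] [FiniteDimensional ℝ F]
    [MeasurableSpace F] [BorelSpace F]
    (μ : Measure E) [μ.IsAddHaarMeasure] (ν : Measure F) [ν.IsAddHaarMeasure]
    {f : E → F} {f' : E →L[ℝ] F} {x : E} (hf : HasStrictFDerivAt f f' x)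
    (hf' : f'.range = ⊤) {N : Set F} (hN : ν N = 0) :
    ∃ V ∈ 𝓝 x, μ (f ⁻¹' N ∩ V) = 0 := by
  obtain ⟨R, hR⟩ := f'.exists_rightInverse_of_surjective hf'
  -- The straightening map `g` is tangent to the identity at `x` and satisfies `f' ∘ g = f`.
  let g : E → E := fun y ↦ y + R (f y - f' y)
  have hfg (y : E) : f' (g y) = f y := by
    have h : f' (R (f y - f' y)) = f y - f' y := DFunLike.congr_fun hR _
    simp only [g, map_add, h]
    abel
  have hg : HasStrictFDerivAt g (ContinuousLinearMap.id ℝ E) x := by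
    have h := (hasStrictFDerivAt_id x).add
      (R.hasStrictFDerivAt.comp x (hf.sub f'.hasStrictFDerivAt))
    rw [sub_self, ContinuousLinearMap.comp_zero, add_zero] at h
    exact h
  have hdet : ((1 / 2 : ℝ≥0) : ℝ≥0∞) <
      ENNReal.ofReal |(ContinuousLinearMap.id ℝ E).det| := by
    simp [ContinuousLinearMap.det]
  obtain ⟨δ, hδ, hδ0⟩ :=
    ((mul_le_addHaar_image_of_lt_det μ _ hdet).and self_mem_nhdsWithin).exists
  obtain ⟨V, hV, hgV⟩ := hg.approximates_deriv_on_nhds (Or.inr hδ0)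
  refine ⟨V, hV, ?_⟩
  have himage : g '' (f ⁻¹' N ∩ V) ⊆ (f' : E →ₗ[ℝ] F) ⁻¹' N := by
    rintro _ ⟨y, ⟨hy, -⟩, rfl⟩
    simpa [hfg] using hy
  have hnull := measure_mono_null himage
    (addHaar_preimage_linearMap_eq_zero μ ν (LinearMap.range_eq_top.1 hf') hN)
  have hle := hδ _ g (hgV.mono_set (Set.inter_subset_right (s := f ⁻¹' N)))
  rw [hnull] at hle
  simpa using hle

/-- if `f : U ⊆ ℝᵐ → ℝⁿ` is `C¹` on the open set `U` and `Df(x)` has rank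
`n` for almost every `x ∈ U`, then preimages of Lebesgue-null sets are Lebesgue-null. -/
theorem null_preimage_of_ae_full_rank (m n : ℕ) (hmn : n ≤ m)
    (U : Set (Fin m → ℝ)) (hU : IsOpen U)
    (f : (Fin m → ℝ) → (Fin n → ℝ)) (hf : ContDiffOn ℝ 1 f U)
    (hrank : ∀ᵐ x ∂(volume : Measure (Fin m → ℝ)), x ∈ U →
      Module.finrank ℝ (LinearMap.range ((fderivWithin ℝ f U x) :
        (Fin m → ℝ) →ₗ[ℝ] (Fin n → ℝ))) = n)
    (N : Set (Fin n → ℝ)) (hN : volume N = 0) :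
    volume (f ⁻¹' N ∩ U) = 0 := by
  let r : Set (Fin m → ℝ) := {x | x ∈ U → Module.finrank ℝ (LinearMap.range
    ((fderivWithin ℝ f U x) : (Fin m → ℝ) →ₗ[ℝ] (Fin n → ℝ))) = n}
  have hrc : volume rᶜ = 0 := hrank
  refine measure_mono_null (t := (f ⁻¹' N ∩ U ∩ r) ∪ rᶜ) (fun x hx ↦ ?_)
    (measure_union_null (measure_null_of_locally_null _ ?_) hrc)
  · by_cases h : x ∈ r
    exacts [Or.inl ⟨hx, h⟩, Or.inr h]
  · rintro x ⟨⟨-, hxU⟩, hxr⟩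
    have hstrict : HasStrictFDerivAt f (fderivWithin ℝ f U x) x := by
      rw [fderivWithin_of_isOpen hU hxU]
      exact (hf.contDiffAt (hU.mem_nhds hxU)).hasStrictFDerivAt one_ne_zero
    have hsurj : (fderivWithin ℝ f U x).range = ⊤ :=
      Submodule.eq_top_of_finrank_eq ((hxr hxU).trans (by simp))
    obtain ⟨V, hV, hVnull⟩ :=
      hstrict.exists_nhds_addHaar_preimage_inter_eq_zero volume volume hsurj hN
    refine ⟨f ⁻¹' N ∩ V, ?_, hVnull⟩
    filter_upwards [self_mem_nhdsWithin, mem_nhdsWithin_of_mem_nhds hV] with y hy hyV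
    exact ⟨hy.1.1, hyV⟩
end
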